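/- arXiv:1705.06736 — 11 statements merged into one kernel-verified Lean document; each statement's English description precedes it below -/
import Mathlib

section
/- Let k and d be odd positive integers, let G be a finite simple graph with p vertices and q edges, and suppose f : V(G) → {1, 2, ..., p-1, p+1} is a bijection such that the induced edge labeling g_f(uv) = |f(u) - f(v)| is a bijection from E(G) onto {k, k+d, k+2d, ..., k+(q-1)d}. Let V_o = {u ∈ V(G) : f(u) is odd} and V_e = V(G) \ V_o. Then the number of edges of G with one endpoint in V_o and the other endpoint in V_e equals ⌊(q+1)/2⌋. -/
/-- For odd `k` and `d`, the odd terms of the progression `k, k + d, …, k + (q - 1) d` are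
those of even index, so there are `⌊(q + 1) / 2⌋` of them. -/
theorem ncard_odd_arithmetic_progression {k d : ℕ} (q : ℕ) (hk : Odd k) (hd : Odd d) :
    {n ∈ (fun i => k + i * d) '' Set.Iio q | Odd n}.ncard = (q + 1) / 2 := by
  have himage : {n ∈ (fun i => k + i * d) '' Set.Iio q | Odd n}
      = (fun j => k + 2 * j * d) '' Set.Iio ((q + 1) / 2) := by
    ext n
    constructor
    · rintro ⟨⟨i, hi, rfl⟩, hodd⟩
      have hieven : Even i := by
        simpa [Nat.odd_add, hk, Nat.even_mul, Nat.not_even_iff_odd.2 hd] using hodd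
      obtain ⟨j, rfl⟩ := hieven
      refine ⟨j, ?_, by ring⟩
      simp only [Set.mem_Iio] at hi ⊢
      omega
    · rintro ⟨j, hj, rfl⟩
      refine ⟨⟨2 * j, ?_, rfl⟩, hk.add_even (by simp)⟩
      simp only [Set.mem_Iio] at hj ⊢
      omega
  have hinj : Function.Injective fun j => k + 2 * j * d := by
    intro a b hab
    have h : 2 * a * d = 2 * b * d := Nat.add_left_cancel hab
    have := Nat.eq_of_mul_eq_mul_right hd.pos h
    omega
  rw [himage, Set.ncard_image_of_injective _ hinj, ← Finset.coe_Iio, Set.ncard_coe_finset,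
    Nat.card_Iio]

/-- The distance between two natural numbers is odd iff exactly one of them is odd. -/
theorem odd_max_sub_min_iff (a b : ℕ) :
    Odd (max a b - min a b) ↔ (Odd a ∧ Even b) ∨ (Odd b ∧ Even a) := by
  simp only [Nat.odd_iff, Nat.even_iff]
  omega

/-- If `k` and `d` are odd positive integers and `f` is a
`(k, d)`-hooked Skolem graceful labeling of a finite simple graph `G`
with `p` vertices and `q` edges, then the number of edges with one
endpoint having odd label and the other even label is `⌊(q+1)/2⌋`. -/
theorem stmt_0 {V : Type*} [Fintype V] (G : SimpleGraph V) (k d p q : ℕ)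
    (hk0 : 0 < k) (hd0 : 0 < d) (hk : Odd k) (hd : Odd d)
    (hp : p = Fintype.card V) (hq : q = G.edgeSet.ncard)
    (f : V → ℕ)
    (hfinj : Function.Injective f)
    (hfim : Set.range f = Set.Icc 1 (p - 1) ∪ {p + 1})
    (gl : Sym2 V → ℕ)
    (hgl : ∀ u v : V, gl s(u, v) = max (f u) (f v) - min (f u) (f v))
    (hglinj : Set.InjOn gl G.edgeSet)
    (hglim : gl '' G.edgeSet = (fun i => k + i * d) '' Set.Iio q) :
    {e ∈ G.edgeSet | ∃ u v : V, e = s(u, v) ∧ Odd (f u) ∧ Even (f v)}.ncard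
      = (q + 1) / 2 := by
  have hcross : {e ∈ G.edgeSet | ∃ u v : V, e = s(u, v) ∧ Odd (f u) ∧ Even (f v)}
      = {e ∈ G.edgeSet | Odd (gl e)} := by
    ext e
    refine and_congr_right fun _ => ⟨?_, ?_⟩
    · rintro ⟨u, v, rfl, hu, hv⟩
      rw [hgl, odd_max_sub_min_iff]
      exact Or.inl ⟨hu, hv⟩
    · induction e with
      | _ u v =>
        rw [hgl, odd_max_sub_min_iff]
        rintro (⟨hu, hv⟩ | ⟨hv, hu⟩)
        · exact ⟨u, v, rfl, hu, hv⟩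
        · exact ⟨v, u, Sym2.eq_swap, hv, hu⟩
  have himage : gl '' {e ∈ G.edgeSet | Odd (gl e)} = {n ∈ gl '' G.edgeSet | Odd n} :=
    Set.image_inter_preimage gl G.edgeSet {n | Odd n}
  rw [hcross, ← (hglinj.mono (Set.sep_subset _ _)).ncard_image, himage, hglim,
    ncard_odd_arithmetic_progression q hk hd]
end

section
/- Let k be an even positive integer and d an odd positive integer, let G be a finite simple graph with p vertices and q edges, and suppose f : V(G) → {1, 2, ..., p-1, p+1} is a bijection such that the induced edge labeling g_f(uv) = |f(u) - f(v)| is a bijection from E(G) onto {k, k+d, k+2d, ..., k+(q-1)d}. Let V_o = {u ∈ V(G) : f(u) is odd} and V_e = V(G) \ V_o. Then the number of edges of G with one endpoint in V_o and the other endpoint in V_e equals ⌊q/2⌋. -/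
/-- An edge joins an odd label to an even label iff the difference of its labels is odd. -/
theorem exists_odd_even_iff_odd_label {V : Type*} (f : V → ℕ) (gl : Sym2 V → ℕ)
    (hgl : ∀ u v : V, gl s(u, v) = max (f u) (f v) - min (f u) (f v)) (e : Sym2 V) :
    (∃ u v : V, e = s(u, v) ∧ Odd (f u) ∧ Even (f v)) ↔ Odd (gl e) := by
  constructor
  · rintro ⟨u, v, rfl, hu, hv⟩
    rw [hgl]
    rw [Nat.odd_iff] at *
    rw [Nat.even_iff] at hv
    omega
  · induction e with
    | _ u v =>
      intro h
      rw [hgl, Nat.odd_iff] at h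
      rcases Nat.even_or_odd (f u) with hu | hu
      · refine ⟨v, u, Sym2.eq_swap, ?_, hu⟩
        rw [Nat.even_iff] at hu
        rw [Nat.odd_iff]
        omega
      · refine ⟨u, v, rfl, hu, ?_⟩
        rw [Nat.odd_iff] at hu
        rw [Nat.even_iff]
        omega

/-- STATEMENT 0: If `k` is even and `d` is odd positive integers and `f` is a
`(k, d)`-hooked Skolem graceful labeling of a finite simple graph `G`
with `p` vertices and `q` edges, then the number of edges with one
endpoint having odd label and the other even label is `⌊q/2⌋`. -/
theorem stmt_1 {V : Type*} [Fintype V] (G : SimpleGraph V) (k d p q : ℕ)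
    (hk0 : 0 < k) (hd0 : 0 < d) (hk : Even k) (hd : Odd d)
    (hp : p = Fintype.card V) (hq : q = G.edgeSet.ncard)
    (f : V → ℕ)
    (hfinj : Function.Injective f)
    (hfim : Set.range f = Set.Icc 1 (p - 1) ∪ {p + 1})
    (gl : Sym2 V → ℕ)
    (hgl : ∀ u v : V, gl s(u, v) = max (f u) (f v) - min (f u) (f v))
    (hglinj : Set.InjOn gl G.edgeSet)
    (hglim : gl '' G.edgeSet = (fun i => k + i * d) '' Set.Iio q) :
    {e ∈ G.edgeSet | ∃ u v : V, e = s(u, v) ∧ Odd (f u) ∧ Even (f v)}.ncard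
      = q / 2 := by
  have hS : {e ∈ G.edgeSet | ∃ u v : V, e = s(u, v) ∧ Odd (f u) ∧ Even (f v)}
      = {e ∈ G.edgeSet | Odd (gl e)} := by
    ext e
    simp only [Set.mem_ofPred_eq, exists_odd_even_iff_odd_label f gl hgl]
  have hodd (i : ℕ) : Odd (k + i * d) ↔ Odd i := by
    simp [Nat.odd_add', hk, Nat.odd_mul, hd]
  have himage : gl '' {e ∈ G.edgeSet | Odd (gl e)}
      = (fun j => k + (2 * j + 1) * d) '' Set.Iio (q / 2) := by
    ext n
    constructor
    · rintro ⟨e, ⟨he, hn⟩, rfl⟩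
      obtain ⟨i, hi, hie⟩ := hglim.subset (Set.mem_image_of_mem gl he)
      simp only [Set.mem_Iio] at hi hie
      rw [← hie, hodd] at hn
      obtain ⟨j, rfl⟩ := hn
      exact ⟨j, Set.mem_Iio.2 (by omega), hie⟩
    · rintro ⟨j, hj, rfl⟩
      rw [Set.mem_Iio] at hj
      obtain ⟨e, he, hej⟩ := hglim.superset ⟨2 * j + 1, Set.mem_Iio.2 (by omega), rfl⟩
      refine ⟨e, ⟨he, ?_⟩, hej⟩
      rw [hej, hodd]
      exact odd_two_mul_add_one j
  have hinj : Function.Injective fun j => k + (2 * j + 1) * d := by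
    intro a b hab
    have := Nat.eq_of_mul_eq_mul_right hd0 (Nat.add_left_cancel hab)
    omega
  rw [hS, ← (hglinj.mono (Set.sep_subset _ _)).ncard_image, himage,
    Set.ncard_image_of_injective _ hinj, ← Finset.coe_Iio, Set.ncard_coe_finset, Nat.card_Iio]
end

section
/- Let k, d, n be positive integers with n ≡ 1 (mod 4). If nK₂ is (k, d)-hooked Skolem graceful, then k is even. -/
/-- `nK₂` is `(k, d)`-hooked Skolem graceful: there are pairs `(aᵢ, bᵢ)` with
`bᵢ > aᵢ`, whose `2n` entries are pairwise distinct and form the set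
`{1, ..., 2n-1} ∪ {2n+1}`, and whose differences form `{k, k+d, ..., k+(n-1)d}`. -/
def IsHookedSkolemGraceful (k d n : ℕ) : Prop :=
  ∃ a b : Fin n → ℕ,
    (∀ i, a i < b i) ∧
    Function.Injective (Sum.elim a b) ∧
    Set.range a ∪ Set.range b = Set.Icc 1 (2 * n - 1) ∪ {2 * n + 1} ∧
    Set.range (fun i => b i - a i) = (fun j => k + j * d) '' Set.Iio n

/-- The endpoints of a hooked labelling sum to `(1 + ⋯ + (2n-1)) + (2n+1)`. -/
theorem sum_add_sum_of_range_eq_hooked {n : ℕ} {a b : Fin n → ℕ} (hn : 0 < n)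
    (hinj : Function.Injective (Sum.elim a b))
    (hr : Set.range a ∪ Set.range b = Set.Icc 1 (2 * n - 1) ∪ {2 * n + 1}) :
    ∑ i, a i + ∑ i, b i = n * (2 * n - 1) + (2 * n + 1) := by
  have himage : Finset.univ.image (Sum.elim a b) =
      insert (2 * n + 1) ((Finset.range (2 * n)).erase 0) := by
    ext x
    have hx := Set.ext_iff.mp hr x
    simp only [Set.mem_union, Set.mem_range, Set.mem_Icc, Set.mem_singleton_iff] at hx
    simp only [Finset.mem_image, Finset.mem_univ, true_and, Sum.exists, Sum.elim_inl,
      Sum.elim_inr, hx, Finset.mem_insert, Finset.mem_erase, Finset.mem_range]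
    omega
  have hsum := Finset.sum_image (f := fun x : ℕ => x) (s := Finset.univ)
    (g := Sum.elim a b) hinj.injOn
  rw [himage, Fintype.sum_sum_type, Finset.sum_insert (by simp),
    Finset.sum_erase (f := fun x : ℕ => x) _ rfl] at hsum
  simp only [Sum.elim_inl, Sum.elim_inr] at hsum
  have hgauss := Finset.sum_range_id_mul_two (2 * n)
  rw [mul_assoc] at hgauss
  lia

/-- A family indexed by `Fin n` with the same range as an arithmetic progression of length `n`
has the same sum. -/
theorem sum_eq_sum_range_of_range_eq {k d n : ℕ} (hd : 0 < d) {f : Fin n → ℕ}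
    (hf : Set.range f = (fun j => k + j * d) '' Set.Iio n) :
    ∑ i, f i = ∑ j ∈ Finset.range n, (k + j * d) := by
  have hprog : Function.Injective fun j : ℕ => k + j * d := fun x y hxy =>
    Nat.eq_of_mul_eq_mul_right hd (Nat.add_left_cancel hxy)
  have himage : Finset.univ.image f = (Finset.range n).image fun j => k + j * d := by
    rw [← Finset.coe_inj]
    simpa using hf
  have hinj : Set.InjOn f (Finset.univ : Finset (Fin n)) := by
    rw [← Finset.card_image_iff, himage, Finset.card_image_of_injective _ hprog]
    simp
  rw [← Finset.sum_image (f := fun x : ℕ => x) hinj, himage,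
    Finset.sum_image hprog.injOn]

/-- if `n ≡ 1 (mod 4)` and `nK₂` is `(k, d)`-hooked Skolem
graceful, then `k` is even. -/
theorem stmt_4 (k d n : ℕ) (hk : 0 < k) (hd : 0 < d) (hn : 0 < n)
    (hn4 : n % 4 = 1) (h : IsHookedSkolemGraceful k d n) : Even k := by
  obtain ⟨a, b, hab, hinj, hr, hdiff⟩ := h
  have hends := sum_add_sum_of_range_eq_hooked hn hinj hr
  have hlen := sum_eq_sum_range_of_range_eq hd hdiff
  have hsub : ∑ i, (b i - a i) + ∑ i, a i = ∑ i, b i := by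
    rw [← Finset.sum_add_distrib]
    exact Finset.sum_congr rfl fun i _ => Nat.sub_add_cancel (hab i).le
  obtain ⟨m, rfl⟩ : ∃ m, n = 4 * m + 1 := ⟨n / 4, by omega⟩
  have hgauss : ∑ j ∈ Finset.range (4 * m + 1), j = 2 * (m * (4 * m + 1)) := by
    have := Finset.sum_range_id_mul_two (4 * m + 1)
    rw [Nat.add_sub_cancel] at this
    linarith
  rw [Finset.sum_add_distrib, ← Finset.sum_mul, hgauss, Finset.sum_const, Finset.card_range,
    smul_eq_mul] at hlen
  have hodd : 2 * (4 * m + 1) - 1 = 8 * m + 1 := by omega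
  rw [hodd] at hends
  have hk2 : k = 2 * (16 * m ^ 2 + 10 * m + 2) -
      2 * (∑ i, a i + 2 * m * k + m * (4 * m + 1) * d) := by
    apply Nat.eq_sub_of_add_eq
    linarith
  exact even_iff_two_dvd.mpr (hk2 ▸ Nat.dvd_sub (dvd_mul_right _ _) (dvd_mul_right _ _))
end

section
/- Let k, d, n be positive integers with n ≡ 3 (mod 4). If nK₂ is (k, d)-hooked Skolem graceful, then k and d have the same parity, i.e., k ≡ d (mod 2) (both are even or both are odd). -/
theorem sum_range_add_mul (k d n : ℕ) :
    2 * ∑ j ∈ Finset.range n, (k + j * d) = 2 * n * k + n * (n - 1) * d := by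
  rw [Finset.sum_add_distrib, ← Finset.sum_mul, mul_add, ← mul_assoc, mul_comm 2 (∑ i ∈ _, i),
    Finset.sum_range_id_mul_two]
  simp [mul_assoc]

theorem sum_hooked_interval {n : ℕ} (hn : 0 < n) :
    ∑ x ∈ Finset.Icc 1 (2 * n - 1) ∪ {2 * n + 1}, x = 2 * n ^ 2 + n + 1 := by
  rw [Finset.sum_union (by simp), Finset.sum_singleton]
  obtain ⟨m, rfl⟩ : ∃ m, n = m + 1 := ⟨n - 1, by omega⟩
  have h : ∀ m : ℕ, ∑ x ∈ Finset.Icc 1 (2 * m + 1), x = (2 * m + 1) * (m + 1) := by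
    intro m
    induction m with
    | zero => simp
    | succ m ih =>
      rw [show 2 * (m + 1) + 1 = 2 * m + 1 + 1 + 1 by ring, Finset.sum_Icc_succ_top (by omega),
        Finset.sum_Icc_succ_top (by omega), ih]
      ring
  rw [show 2 * (m + 1) - 1 = 2 * m + 1 by omega, h]
  ring

namespace IsHookedSkolemGraceful

/-- The labels sum to `2n² + n + 1`, and the sum of the labels exceeds the sum of the differences
by twice the sum of the smaller endpoints. -/
theorem exists_sum_eq {k d n : ℕ} (hd : 0 < d) (hn : 0 < n) (h : IsHookedSkolemGraceful k d n) :
    ∃ s, 2 * n ^ 2 + n + 1 = 2 * s + ∑ j ∈ Finset.range n, (k + j * d) := by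
  obtain ⟨a, b, hab, hinj, hlabels, hdiff⟩ := h
  have labels : Finset.univ.image (Sum.elim a b) = Finset.Icc 1 (2 * n - 1) ∪ {2 * n + 1} := by
    apply Finset.coe_injective
    simpa [Set.Sum.elim_range] using hlabels
  have diffs : Finset.univ.image (fun i => b i - a i) =
      (Finset.range n).image (fun j => k + j * d) := by
    apply Finset.coe_injective
    simpa using hdiff
  have prog_inj : Function.Injective (fun j => k + j * d) := fun x y hxy =>
    Nat.eq_of_mul_eq_mul_right hd (Nat.add_left_cancel hxy)
  have diff_inj : Set.InjOn (fun i => b i - a i) (Finset.univ : Finset (Fin n)) := by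
    rw [← Finset.card_image_iff, diffs, Finset.card_image_of_injective _ prog_inj]
    simp
  have sum_labels : ∑ i, a i + ∑ i, b i = 2 * n ^ 2 + n + 1 := by
    rw [← sum_hooked_interval hn, ← labels, Finset.sum_image hinj.injOn, Fintype.sum_sum_type]
    rfl
  have sum_diffs : ∑ i, (b i - a i) = ∑ j ∈ Finset.range n, (k + j * d) := by
    have := congrArg (fun s : Finset ℕ => ∑ x ∈ s, x) diffs
    simpa only [Finset.sum_image diff_inj, Finset.sum_image prog_inj.injOn] using this
  have sum_b : ∑ i, b i = ∑ i, a i + ∑ i, (b i - a i) := by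
    rw [← Finset.sum_add_distrib]
    exact Finset.sum_congr rfl fun i _ => (Nat.add_sub_cancel' (hab i).le).symm
  exact ⟨∑ i, a i, by omega⟩

end IsHookedSkolemGraceful

/-- STATEMENT 4: if `n ≡ 3 (mod 4)` and `nK₂` is `(k, d)`-hooked Skolem
graceful, then `k` and `d` have the same parity. -/
theorem stmt_6 (k d n : ℕ) (hk : 0 < k) (hd : 0 < d) (hn : 0 < n)
    (hn4 : n % 4 = 3) (h : IsHookedSkolemGraceful k d n) : k % 2 = d % 2 := by
  obtain ⟨s, hs⟩ := h.exists_sum_eq hd hn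
  have hsum := sum_range_add_mul k d n
  generalize ∑ j ∈ Finset.range n, (k + j * d) = t at hs hsum
  obtain ⟨m, rfl⟩ : ∃ m, n = 4 * m + 3 := ⟨n / 4, by omega⟩
  rw [show 4 * m + 3 - 1 = 4 * m + 2 by omega] at hsum
  ring_nf at hs hsum
  omega
end

section
/- Let d and m be positive integers. If the sequence {d, d+1, ..., d+m-1} is hooked, i.e., the set {1, 2, ..., 2m-1, 2m+1} can be partitioned into m pairs (aᵢ, bᵢ) with bᵢ > aᵢ such that the differences bᵢ - aᵢ are exactly the integers d, d+1, ..., d+m-1, then m(m+1-2d) + 2 ≥ 0 (as integers). -/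
/-- The sequence `{d, d+1, ..., d+m-1}` is hooked: the set `{1, ..., 2m-1, 2m+1}`
can be partitioned into `m` pairs `(aᵢ, bᵢ)` with `bᵢ > aᵢ` whose differences
are exactly `d, d+1, ..., d+m-1`. -/
def IsHookedSequence (d m : ℕ) : Prop :=
  ∃ a b : Fin m → ℕ,
    (∀ i, a i < b i) ∧
    Function.Injective (Sum.elim a b) ∧
    Set.range a ∪ Set.range b = Set.Icc 1 (2 * m - 1) ∪ {2 * m + 1} ∧
    Set.range (fun i => b i - a i) = Set.Icc d (d + m - 1)

/-- A finite set of `n` positive natural numbers has sum at least `n(n+1)/2`. -/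
theorem card_mul_card_succ_le_two_mul_sum (s : Finset ℕ) (hs : ∀ x ∈ s, 0 < x) :
    s.card * (s.card + 1) ≤ 2 * ∑ x ∈ s, x := by
  induction s using Finset.induction_on_max with
  | empty => simp
  | insert y s hy ih =>
    have hys : y ∉ s := fun h => lt_irrefl _ (hy y h)
    have hcard : s.card + 1 ≤ y := by
      have hsub : s ⊆ Finset.Icc 1 (y - 1) := by
        intro x hx
        have h1 := hy x hx
        have h2 := hs x (Finset.mem_insert_of_mem hx)
        simp only [Finset.mem_Icc]
        omega
      have h3 := Finset.card_le_card hsub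
      have h4 := hs y (Finset.mem_insert_self y s)
      simp only [Nat.card_Icc] at h3
      omega
    have hsum := ih fun x hx => hs x (Finset.mem_insert_of_mem hx)
    rw [Finset.card_insert_of_notMem hys, Finset.sum_insert hys]
    nlinarith

theorem two_mul_sum_Ico_add (d m : ℕ) :
    2 * ∑ x ∈ Finset.Ico d (d + m), (x : ℤ) = m * (2 * d + m - 1) := by
  induction m with
  | zero => simp
  | succ m ih =>
    rw [← add_assoc, Finset.sum_Ico_succ_top (by omega), mul_add, ih]
    push_cast
    ring

/-- if `{d, ..., d+m-1}` is hooked, then `m(m+1-2d) + 2 ≥ 0`. -/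
theorem stmt_7 (d m : ℕ) (hd : 0 < d) (hm : 0 < m)
    (h : IsHookedSequence d m) :
    0 ≤ (m : ℤ) * ((m : ℤ) + 1 - 2 * (d : ℤ)) + 2 := by
  obtain ⟨a, b, hab, hinj, hrange, hdiff⟩ := h
  have ha : Function.Injective a := hinj.comp Sum.inl_injective
  have hpos : ∀ i, 0 < a i := by
    intro i
    have hi : a i ∈ Set.range a ∪ Set.range b := Or.inl ⟨i, rfl⟩
    rw [hrange] at hi
    simp only [Set.mem_union, Set.mem_Icc, Set.mem_singleton_iff] at hi
    omega
  have hlow : m * (m + 1) ≤ 2 * ∑ i, a i := by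
    have := card_mul_card_succ_le_two_mul_sum (Finset.univ.image a) (by simpa using hpos)
    rwa [Finset.card_image_of_injective _ ha, Finset.sum_image ha.injOn, Finset.card_univ,
      Fintype.card_fin] at this
  have htotal : ∑ i, (a i : ℤ) + ∑ i, (b i : ℤ) = m * (2 * m + 1) + 1 := by
    have himage : Finset.univ.image (Sum.elim a b) =
        insert (2 * m + 1) (Finset.Ico 1 (1 + (2 * m - 1))) := by
      apply Finset.coe_injective
      rw [Finset.coe_image, Finset.coe_univ, Set.image_univ, Set.Sum.elim_range, hrange]
      ext x
      simp only [Set.mem_union, Set.mem_Icc, Set.mem_singleton_iff, Finset.coe_insert,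
        Finset.coe_Ico, Set.mem_insert_iff, Set.mem_Ico]
      omega
    have hsum := Finset.sum_image (s := Finset.univ) (f := fun x : ℕ => (x : ℤ)) hinj.injOn
    rw [himage, Finset.sum_insert (by simp only [Finset.mem_Ico]; omega),
      Fintype.sum_sum_type] at hsum
    simp only [Sum.elim_inl, Sum.elim_inr] at hsum
    have hIco := two_mul_sum_Ico_add 1 (2 * m - 1)
    push_cast [Nat.cast_sub (show 1 ≤ 2 * m by omega)] at hIco hsum
    linarith
  have hdiffs : 2 * (∑ i, (b i : ℤ) - ∑ i, (a i : ℤ)) = m * (2 * d + m - 1) := by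
    have himage : Finset.univ.image (fun i => b i - a i) = Finset.Ico d (d + m) := by
      apply Finset.coe_injective
      rw [Finset.coe_image, Finset.coe_univ, Set.image_univ, hdiff]
      ext x
      simp only [Set.mem_Icc, Finset.coe_Ico, Set.mem_Ico]
      omega
    have hinj' := Finset.card_image_iff.mp
      (show (Finset.univ.image (fun i => b i - a i)).card = (Finset.univ : Finset (Fin m)).card by
        simp [himage])
    rw [← two_mul_sum_Ico_add, ← himage, Finset.sum_image hinj', ← Finset.sum_sub_distrib]
    congr 1
    exact Finset.sum_congr rfl fun i _ => (Nat.cast_sub (hab i).le).symm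
  zify at hlow
  nlinarith
end

section
/- Let d and m be positive integers. If the sequence {d, d+1, ..., d+m-1} is hooked, i.e., the set {1, 2, ..., 2m-1, 2m+1} can be partitioned into m pairs (aᵢ, bᵢ) with bᵢ > aᵢ such that the differences bᵢ - aᵢ are exactly the integers d, d+1, ..., d+m-1, then: if d is odd, m ≡ 2 or 3 (mod 4), and if d is even, m ≡ 1 or 2 (mod 4). -/
theorem Finset.sum_Icc_id_mul_two_add (d m : ℕ) (hm : 0 < m) :
    (∑ x ∈ Finset.Icc d (d + m - 1), x) * 2 + m = m * m + 2 * m * d := by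
  obtain ⟨n, rfl⟩ : ∃ n, m = n + 1 := ⟨m - 1, by omega⟩
  clear hm
  induction n with
  | zero => simp; omega
  | succ n ih =>
    rw [show d + (n + 1 + 1) - 1 = d + n + 1 by omega, Finset.sum_Icc_succ_top (by omega)]
    rw [show d + (n + 1) - 1 = d + n by omega] at ih
    nlinarith

/-- if `{d, ..., d+m-1}` is hooked, then `m ≡ 2` or `3 (mod 4)`
for `d` odd, and `m ≡ 1` or `2 (mod 4)` for `d` even. -/
theorem stmt_8 (d m : ℕ) (hd : 0 < d) (hm : 0 < m)
    (h : IsHookedSequence d m) :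
    (Odd d → m % 4 = 2 ∨ m % 4 = 3) ∧ (Even d → m % 4 = 1 ∨ m % 4 = 2) := by
  obtain ⟨a, b, hlt, hinj, hpos, hdiff⟩ := h
  have hposF : Finset.univ.image (Sum.elim a b) =
      insert (2 * m + 1) (Finset.Icc 1 (1 + (2 * m - 1) - 1)) := by
    apply Finset.coe_injective
    rw [show 1 + (2 * m - 1) - 1 = 2 * m - 1 by omega]
    simp only [Finset.coe_image, Finset.coe_univ, Set.image_univ, Finset.coe_insert,
      Finset.coe_Icc]
    rw [Set.Sum.elim_range, hpos, Set.union_singleton]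
  have hdiffF : Finset.univ.image (fun i => b i - a i) = Finset.Icc d (d + m - 1) := by
    apply Finset.coe_injective
    simpa using hdiff
  have hdinj : Set.InjOn (fun i => b i - a i) (Finset.univ : Finset (Fin m)) := by
    rw [← Finset.card_image_iff, hdiffF]
    simp
    omega
  have hsumpos : ∑ i, a i + ∑ i, b i =
      2 * m + 1 + ∑ x ∈ Finset.Icc 1 (1 + (2 * m - 1) - 1), x := by
    rw [← Finset.sum_insert (f := fun x => x) (by simp only [Finset.mem_Icc]; omega), ← hposF,
      Finset.sum_image (fun _ _ _ _ e => hinj e)]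
    simp
  have hsumdiff : ∑ i, (b i - a i) = ∑ x ∈ Finset.Icc d (d + m - 1), x := by
    rw [← hdiffF, Finset.sum_image hdinj]
  have hsplit : ∑ i, b i = ∑ i, a i + ∑ i, (b i - a i) := by
    rw [← Finset.sum_add_distrib]
    exact Finset.sum_congr rfl fun i _ => by have := hlt i; omega
  have h₁ := Finset.sum_Icc_id_mul_two_add 1 (2 * m - 1) (by omega)
  have h₂ := Finset.sum_Icc_id_mul_two_add d m hm
  rw [← hsumdiff] at h₂
  generalize ∑ x ∈ Finset.Icc 1 (1 + (2 * m - 1) - 1), x = T at *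
  generalize ∑ i, (b i - a i) = D at *
  generalize ∑ i, a i = A at *
  generalize ∑ i, b i = B at *
  have hT : T = m * (2 * m - 1) := by
    obtain ⟨n, rfl⟩ : ∃ n, m = n + 1 := ⟨m - 1, by omega⟩
    rw [show 2 * (n + 1) - 1 = 2 * n + 1 by omega] at *
    nlinarith
  have key : 4 * A + m * m + 2 * m * d = 4 * (m * m) + 3 * m + 2 := by
    obtain ⟨n, rfl⟩ : ∃ n, m = n + 1 := ⟨m - 1, by omega⟩
    rw [show 2 * (n + 1) - 1 = 2 * n + 1 by omega] at *
    nlinarith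
  have hr : m = 4 * (m / 4) + m % 4 := by omega
  have hr4 : m % 4 < 4 := Nat.mod_lt _ (by norm_num)
  generalize m / 4 = q at hr
  generalize m % 4 = r at *
  constructor <;> rintro ⟨k, rfl⟩ <;> subst hr <;> interval_cases r <;>
    ring_nf at key <;> omega
end

section
/- Let n be a positive integer. If nK₂ is (2, 1)-hooked Skolem graceful, i.e., the set {1, 2, ..., 2n-1, 2n+1} can be partitioned into n pairs (aᵢ, bᵢ) with bᵢ > aᵢ whose differences bᵢ - aᵢ are exactly the integers 2, 3, ..., n+1, then n ≡ 1 or 2 (mod 4). -/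
/-- The sum of the labels `1, ..., 2n-1, 2n+1`. -/
theorem sum_hooked_labels (n : ℕ) (hn : 0 < n) :
    ∑ x ∈ Finset.Icc 1 (2 * n - 1) ∪ {2 * n + 1}, x = 2 * n ^ 2 + n + 1 := by
  rw [Finset.sum_union (by simp), Finset.sum_singleton]
  obtain ⟨m, rfl⟩ : ∃ m, n = m + 1 := ⟨n - 1, by omega⟩
  clear hn
  induction m with
  | zero => simp
  | succ k ih =>
    have h : 2 * (k + 1 + 1) - 1 = (2 * (k + 1) - 1) + 1 + 1 := by omega
    rw [h, Finset.sum_Icc_succ_top (by omega), Finset.sum_Icc_succ_top (by omega)]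
    have h' : 2 * (k + 1) - 1 = 2 * k + 1 := by omega
    rw [h'] at ih ⊢
    linarith

/-- Twice the sum of the differences `2, ..., n+1`. -/
theorem two_mul_sum_Icc_two (n : ℕ) :
    2 * ∑ x ∈ Finset.Icc 2 (n + 1), x = n ^ 2 + 3 * n := by
  induction n with
  | zero => simp
  | succ k ih =>
    rw [Finset.sum_Icc_succ_top (by omega), mul_add, ih]
    ring


/-- `nK₂` is `(2, 1)`-hooked Skolem graceful: there are pairs `(aᵢ, bᵢ)` with
`bᵢ > aᵢ`, whose `2n` entries are pairwise distinct and form the set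
`{1, ..., 2n-1} ∪ {2n+1}`, and whose differences form `{2, 3, ..., n+1}`. -/
def IsHookedSkolemGraceful21 (n : ℕ) : Prop :=
  ∃ a b : Fin n → ℕ,
    (∀ i, a i < b i) ∧
    Function.Injective (Sum.elim a b) ∧
    Set.range a ∪ Set.range b = Set.Icc 1 (2 * n - 1) ∪ {2 * n + 1} ∧
    Set.range (fun i => b i - a i) = Set.Icc 2 (n + 1)

/-- if `nK₂` is `(2, 1)`-hooked Skolem graceful then
`n ≡ 1` or `2 (mod 4)`. -/
theorem stmt_9 (n : ℕ) (hn : 0 < n) (h : IsHookedSkolemGraceful21 n) :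
    n % 4 = 1 ∨ n % 4 = 2 := by
  obtain ⟨a, b, hlt, hinj, hrange, hdiff⟩ := h
  have hlabels : ∑ i, a i + ∑ i, b i = 2 * n ^ 2 + n + 1 := by
    have himage : Finset.univ.image (Sum.elim a b) =
        Finset.Icc 1 (2 * n - 1) ∪ {2 * n + 1} := by
      apply Finset.coe_injective
      simpa [Set.Sum.elim_range] using hrange
    rw [← sum_hooked_labels n hn, ← himage, Finset.sum_image hinj.injOn, Fintype.sum_sum_type]
    simp
  have hdiffs : 2 * ∑ i, (b i - a i) = n ^ 2 + 3 * n := by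
    have himage : Finset.univ.image (fun i => b i - a i) = Finset.Icc 2 (n + 1) := by
      apply Finset.coe_injective
      simpa using hdiff
    have hinjOn : Set.InjOn (fun i => b i - a i) (Finset.univ : Finset (Fin n)) := by
      apply Finset.injOn_of_card_image_eq
      simp [himage]
    rw [← two_mul_sum_Icc_two, ← himage, Finset.sum_image hinjOn]
  have hsum : ∑ i, (b i - a i) + ∑ i, a i = ∑ i, b i := by
    rw [← Finset.sum_add_distrib]
    exact Finset.sum_congr rfl fun i _ => Nat.sub_add_cancel (hlt i).le
  have hmod : (n ^ 2 + 3 * n) % 4 = (2 * n + 2) % 4 := by omega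
  have hn4 : n % 4 < 4 := Nat.mod_lt _ (by norm_num)
  rw [Nat.add_mod, Nat.pow_mod, Nat.mul_mod, Nat.add_mod (2 * n), Nat.mul_mod 2 n] at hmod
  interval_cases n % 4 <;> simp_all
end

section
/- Let n be a positive integer with n ≡ 1 (mod 4). Then nK₂ is (2, 1)-hooked Skolem graceful; that is, the set {1, 2, ..., 2n-1, 2n+1} can be partitioned into n pairs (aᵢ, bᵢ) with bᵢ > aᵢ whose differences bᵢ - aᵢ are exactly the integers 2, 3, ..., n+1. -/
/-- The smaller element of the pair with difference `d` in the partition of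
`{1, ..., 8 * m + 1} ∪ {8 * m + 3}` into pairs with differences `2, ..., 4 * m + 2`. -/
def hookedLeft (m d : ℕ) : ℕ :=
  if d = 4 * m + 2 then 2 * m + 1
  else if d = 4 * m + 1 then m + 1
  else if d = 2 * m + 1 then 6 * m + 2
  else if d = 2 * m then 3 * m + 1
  else if d % 2 = 0 then (4 * m + 2 - d) / 2
  else if 2 * m + 1 < d then 4 * m + 2 + (4 * m - 1 - d) / 2
  else 4 * m + 2 + (4 * m + 1 - d) / 2

theorem hookedLeft_injOn (m : ℕ) : Set.InjOn (hookedLeft m) (Set.Icc 2 (4 * m + 2)) := by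
  rintro d ⟨hd, hd'⟩ e ⟨he, he'⟩ h
  unfold hookedLeft at h
  split_ifs at h <;> omega

theorem hookedLeft_add_injOn (m : ℕ) :
    Set.InjOn (fun d => hookedLeft m d + d) (Set.Icc 2 (4 * m + 2)) := by
  rintro d ⟨hd, hd'⟩ e ⟨he, he'⟩ h
  simp only [hookedLeft] at h
  split_ifs at h <;> omega

theorem hookedLeft_ne_hookedLeft_add {m d e : ℕ} (hd : d ∈ Set.Icc 2 (4 * m + 2))
    (he : e ∈ Set.Icc 2 (4 * m + 2)) : hookedLeft m d ≠ hookedLeft m e + e := by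
  obtain ⟨hd, hd'⟩ := hd
  obtain ⟨he, he'⟩ := he
  intro h
  unfold hookedLeft at h
  split_ifs at h <;> omega

theorem hookedLeft_mem {m d : ℕ} (hd : d ∈ Set.Icc 2 (4 * m + 2)) :
    hookedLeft m d ∈ Finset.Icc 1 (8 * m + 1) ∪ {8 * m + 3} := by
  obtain ⟨hd, hd'⟩ := hd
  simp only [Finset.mem_union, Finset.mem_Icc, Finset.mem_singleton]
  unfold hookedLeft
  split_ifs <;> omega

theorem hookedLeft_add_mem {m d : ℕ} (hd : d ∈ Set.Icc 2 (4 * m + 2)) :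
    hookedLeft m d + d ∈ Finset.Icc 1 (8 * m + 1) ∪ {8 * m + 3} := by
  obtain ⟨hd, hd'⟩ := hd
  simp only [Finset.mem_union, Finset.mem_Icc, Finset.mem_singleton]
  unfold hookedLeft
  split_ifs <;> omega

/-- if `n ≡ 1 (mod 4)` then `nK₂` is `(2, 1)`-hooked Skolem
graceful. -/
theorem stmt_10 (n : ℕ) (hn : 0 < n) (hn4 : n % 4 = 1) :
    IsHookedSkolemGraceful21 n := by
  obtain ⟨m, rfl⟩ : ∃ m, n = 4 * m + 1 := ⟨n / 4, by omega⟩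
  have hmem (i : Fin (4 * m + 1)) : (i : ℕ) + 2 ∈ Set.Icc 2 (4 * m + 2) :=
    ⟨by omega, by omega⟩
  let a : Fin (4 * m + 1) → ℕ := fun i => hookedLeft m (i + 2)
  let b : Fin (4 * m + 1) → ℕ := fun i => hookedLeft m (i + 2) + (i + 2)
  have hinj : Function.Injective (Sum.elim a b) := by
    refine Function.Injective.sumElim (fun i j h => ?_) (fun i j h => ?_) (fun i j => ?_)
    · have := hookedLeft_injOn m (hmem i) (hmem j) h
      exact Fin.ext (by omega)
    · have := hookedLeft_add_injOn m (hmem i) (hmem j) h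
      exact Fin.ext (by omega)
    · exact hookedLeft_ne_hookedLeft_add (hmem i) (hmem j)
  refine ⟨a, b, fun i => ?_, hinj, ?_, ?_⟩
  · simp only [a, b]
    omega
  · have himage : Finset.univ.image (Sum.elim a b) =
        Finset.Icc 1 (8 * m + 1) ∪ {8 * m + 3} := by
      apply Finset.eq_of_subset_of_card_le
      · intro x hx
        obtain ⟨i | i, -, rfl⟩ := Finset.mem_image.mp hx
        · exact hookedLeft_mem (hmem i)
        · exact hookedLeft_add_mem (hmem i)
      · rw [Finset.card_image_of_injective _ hinj]
        refine (Finset.card_union_le _ _).trans ?_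
        simp only [Nat.card_Icc, Finset.card_singleton, Finset.card_univ, Fintype.card_sum,
          Fintype.card_fin]
        omega
    rw [← Set.Sum.elim_range, ← Set.image_univ, ← Finset.coe_univ, ← Finset.coe_image, himage]
    ext x
    simp only [Finset.coe_union, Finset.coe_Icc, Finset.coe_singleton, Set.mem_union,
      Set.mem_Icc, Set.mem_singleton_iff]
    omega
  · ext d
    simp only [a, b, Set.mem_range, Set.mem_Icc, Nat.add_sub_cancel_left]
    constructor
    · rintro ⟨i, rfl⟩
      omega
    · rintro ⟨h, h'⟩
      exact ⟨⟨d - 2, by omega⟩, by simp only; omega⟩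
end

section
/- Let n be a positive integer with n ≡ 2 (mod 4). Then nK₂ is (2, 1)-hooked Skolem graceful; that is, the set {1, 2, ..., 2n-1, 2n+1} can be partitioned into n pairs (aᵢ, bᵢ) with bᵢ > aᵢ whose differences bᵢ - aᵢ are exactly the integers 2, 3, ..., n+1. -/
/-- To show that `nK₂` is `(2, 1)`-hooked Skolem graceful, it suffices to give the left endpoint
`s d` of the pair with difference `d`, such that the pairs stay within and cover the
required positions; distinctness then follows by counting. -/
theorem IsHookedSkolemGraceful21.of_leftEndpoint {n : ℕ} (hn : 0 < n) (s : ℕ → ℕ)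
    (hmem : ∀ d, 2 ≤ d → d ≤ n + 1 →
      (1 ≤ s d ∧ s d ≤ 2 * n - 1) ∧ (s d + d ≤ 2 * n - 1 ∨ s d + d = 2 * n + 1))
    (hcover : ∀ p, (1 ≤ p ∧ p ≤ 2 * n - 1) ∨ p = 2 * n + 1 →
      ∃ d, 2 ≤ d ∧ d ≤ n + 1 ∧ (p = s d ∨ p = s d + d)) :
    IsHookedSkolemGraceful21 n := by
  let a : Fin n → ℕ := fun i => s (i + 2)
  let b : Fin n → ℕ := fun i => s (i + 2) + (i + 2)
  have hrange : Set.range a ∪ Set.range b = Set.Icc 1 (2 * n - 1) ∪ {2 * n + 1} := by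
    ext p
    simp only [Set.mem_union, Set.mem_range, Set.mem_Icc, Set.mem_singleton_iff]
    constructor
    · rintro (⟨i, rfl⟩ | ⟨i, rfl⟩)
      · have := hmem (i + 2) (by omega) (by omega)
        simp only [a]
        omega
      · have := hmem (i + 2) (by omega) (by omega)
        simp only [b]
        omega
    · intro hp
      obtain ⟨d, hd2, hdn, h⟩ := hcover p hp
      have hd : d - 2 + 2 = d := by omega
      rcases h with rfl | rfl
      · exact Or.inl ⟨⟨d - 2, by omega⟩, by simp only [a, hd]⟩
      · exact Or.inr ⟨⟨d - 2, by omega⟩, by simp only [b, hd]⟩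
  refine ⟨a, b, fun i => by simp only [a, b]; omega, ?_, hrange, ?_⟩
  · have himage : Finset.univ.image (Sum.elim a b) =
        insert (2 * n + 1) (Finset.Icc 1 (2 * n - 1)) := by
      apply Finset.coe_injective
      rw [Finset.coe_image, Finset.coe_univ, Set.image_univ, Set.Sum.elim_range, hrange,
        Finset.coe_insert, Finset.coe_Icc, Set.union_singleton]
    have hinj : Set.InjOn (Sum.elim a b) (Finset.univ : Finset (Fin n ⊕ Fin n)) := by
      rw [← Finset.card_image_iff, himage, Finset.card_insert_of_notMem (by simp),
        Nat.card_Icc, Finset.card_univ, Fintype.card_sum, Fintype.card_fin]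
      omega
    rwa [Finset.coe_univ, Set.injOn_univ] at hinj
  · ext d
    simp only [a, b, Set.mem_range, Set.mem_Icc]
    constructor
    · rintro ⟨i, rfl⟩
      omega
    · rintro ⟨hd2, hdn⟩
      exact ⟨⟨d - 2, by omega⟩, by dsimp only; omega⟩

/-- Left endpoints, indexed by the difference, for `n = 4 * k + 2` with `2 ≤ k`. -/
def hookedLeftEndpoint (k d : ℕ) : ℕ :=
  if d % 2 = 0 then
    if d ≤ 2 * k then 6 * k + 2 - d / 2
    else if d ≤ 4 * k - 4 then 2 * k + 1 - d / 2
    else if d = 4 * k - 2 then k + 2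
    else if d = 4 * k then k + 1
    else 3 * k + 1
  else
    if d ≤ 2 * k - 3 then 2 * k + 1 - d / 2
    else if d = 2 * k - 1 then 2
    else if d = 2 * k + 1 then 1
    else if d = 2 * k + 3 then 6 * k + 2
    else 6 * k + 1 - d / 2

set_option maxHeartbeats 1000000 in
theorem isHookedSkolemGraceful21_four_mul_add_two {k : ℕ} (hk : 2 ≤ k) :
    IsHookedSkolemGraceful21 (4 * k + 2) := by
  refine .of_leftEndpoint (by omega) (hookedLeftEndpoint k) (fun d hd2 hdn => ?_) fun p hp => ?_
  · unfold hookedLeftEndpoint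
    split_ifs <;> omega
  · have cover (d : ℕ) (hd2 : 2 ≤ d) (hdn : d ≤ 4 * k + 2 + 1)
        (h : ∀ v, hookedLeftEndpoint k d = v → p = v ∨ p = v + d) :
        ∃ d, 2 ≤ d ∧ d ≤ 4 * k + 2 + 1 ∧
          (p = hookedLeftEndpoint k d ∨ p = hookedLeftEndpoint k d + d) :=
      ⟨d, hd2, hdn, h _ rfl⟩
    unfold hookedLeftEndpoint at cover ⊢
    obtain h | h | h | h | h | h | h | h | h | h | h | h | h | h | h | h | h | h | h | h :
        p = 1 ∨ p = 2 ∨ (3 ≤ p ∧ p ≤ k) ∨ p = k + 1 ∨ p = k + 2 ∨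
        (k + 3 ≤ p ∧ p ≤ 2 * k) ∨ p = 2 * k + 1 ∨ p = 2 * k + 2 ∨
        (2 * k + 3 ≤ p ∧ p ≤ 3 * k) ∨ p = 3 * k + 1 ∨ (3 * k + 2 ≤ p ∧ p ≤ 4 * k - 1) ∨
        (4 * k ≤ p ∧ p ≤ 5 * k - 1) ∨ p = 5 * k ∨ p = 5 * k + 1 ∨
        (5 * k + 2 ≤ p ∧ p ≤ 6 * k + 1) ∨ p = 6 * k + 2 ∨ (6 * k + 3 ≤ p ∧ p ≤ 7 * k + 2) ∨
        p = 7 * k + 3 ∨ (7 * k + 4 ≤ p ∧ p ≤ 8 * k + 3) ∨ p = 8 * k + 5 := by omega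
    · exact cover (2 * k + 1) (by omega) (by omega) fun v hv => by split_ifs at hv <;> omega
    · exact cover (2 * k - 1) (by omega) (by omega) fun v hv => by split_ifs at hv <;> omega
    · exact cover (4 * k + 2 - 2 * p) (by omega) (by omega) fun v hv => by split_ifs at hv <;> omega
    · exact cover (4 * k) (by omega) (by omega) fun v hv => by split_ifs at hv <;> omega
    · exact cover (4 * k - 2) (by omega) (by omega) fun v hv => by split_ifs at hv <;> omega
    · exact cover (4 * k + 3 - 2 * p) (by omega) (by omega) fun v hv => by split_ifs at hv <;> omega
    · exact cover (2 * k - 1) (by omega) (by omega) fun v hv => by split_ifs at hv <;> omega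
    · exact cover (2 * k + 1) (by omega) (by omega) fun v hv => by split_ifs at hv <;> omega
    · exact cover (2 * (p - 2 * k - 2) + 1) (by omega) (by omega)
        fun v hv => by split_ifs at hv <;> omega
    · exact cover (4 * k + 2) (by omega) (by omega) fun v hv => by split_ifs at hv <;> omega
    · exact cover (2 * (p - 2 * k - 1)) (by omega) (by omega)
        fun v hv => by split_ifs at hv <;> omega
    · exact cover (2 * (6 * k + 1 - p) + 1) (by omega) (by omega)
        fun v hv => by split_ifs at hv <;> omega
    · exact cover (4 * k - 2) (by omega) (by omega) fun v hv => by split_ifs at hv <;> omega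
    · exact cover (4 * k) (by omega) (by omega) fun v hv => by split_ifs at hv <;> omega
    · exact cover (2 * (6 * k + 2 - p)) (by omega) (by omega)
        fun v hv => by split_ifs at hv <;> omega
    · exact cover (2 * k + 3) (by omega) (by omega) fun v hv => by split_ifs at hv <;> omega
    · exact cover (2 * (p - 6 * k - 2)) (by omega) (by omega)
        fun v hv => by split_ifs at hv <;> omega
    · exact cover (4 * k + 2) (by omega) (by omega) fun v hv => by split_ifs at hv <;> omega
    · exact cover (2 * (p - 6 * k - 2) + 1) (by omega) (by omega)
        fun v hv => by split_ifs at hv <;> omega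
    · exact cover (2 * k + 3) (by omega) (by omega) fun v hv => by split_ifs at hv <;> omega

theorem isHookedSkolemGraceful21_two : IsHookedSkolemGraceful21 2 := by
  refine .of_leftEndpoint (by omega) (fun d => d - 1)
    (fun d hd2 hdn => by omega) fun p hp => ?_
  obtain h | h : (p = 1 ∨ p = 3) ∨ p = 2 ∨ p = 5 := by omega
  · exact ⟨2, by omega⟩
  · exact ⟨3, by omega⟩

theorem isHookedSkolemGraceful21_six : IsHookedSkolemGraceful21 6 := by
  refine .of_leftEndpoint (by omega)
    (fun d => if d = 2 then 11 else if d = 7 then 1 else if d = 5 then 2 else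
      if d = 3 then 3 else if d = 6 then 4 else 5) (fun d hd2 hdn => ?_) fun p hp => ?_
  · split_ifs <;> omega
  · have hp13 : p ≤ 13 := by omega
    interval_cases p <;> first
      | omega
      | exact ⟨2, by decide⟩
      | exact ⟨3, by decide⟩
      | exact ⟨4, by decide⟩
      | exact ⟨5, by decide⟩
      | exact ⟨6, by decide⟩
      | exact ⟨7, by decide⟩

/-- if `n ≡ 2 (mod 4)` then `nK₂` is `(2, 1)`-hooked Skolem
graceful. -/
theorem stmt_11 (n : ℕ) (hn : 0 < n) (hn4 : n % 4 = 2) :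
    IsHookedSkolemGraceful21 n := by
  obtain ⟨k, rfl⟩ : ∃ k, n = 4 * k + 2 := ⟨n / 4, by omega⟩
  obtain rfl | rfl | hk : k = 0 ∨ k = 1 ∨ 2 ≤ k := by omega
  · exact isHookedSkolemGraceful21_two
  · exact isHookedSkolemGraceful21_six
  · exact isHookedSkolemGraceful21_four_mul_add_two hk
end

section
/- Let r ≥ 4 be an integer and set n = 4r - 2. Define, for 1 ≤ i ≤ n: aᵢ = i for i = 1, 2; aᵢ = i + 1 for 3 ≤ i ≤ 2r-2; aᵢ = (n+4)/2 for i = 2r-1; aᵢ = (3n+2)/4 for i = 2r; aᵢ = (n-4)/2 + i for 2r+1 ≤ i ≤ n; and bᵢ = 3 for i = 1; bᵢ = (n+2)/2 for i = 2; bᵢ = n+2-i for 3 ≤ i ≤ r; bᵢ = n+1-i for r+1 ≤ i ≤ 2r-3; bᵢ = 3n/2 for i = 2r-2; bᵢ = (3n-2)/2 for i = 2r-1; bᵢ = (7n-2)/4 for i = 2r; bᵢ = 2n+1 for i = 2r+1; bᵢ = (5n+4)/2 - i for 2r+2 ≤ i ≤ 3r; bᵢ = (5n+2)/2 - i for 3r+1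 ≤ i ≤ n. Then the 2n numbers a₁, ..., aₙ, b₁, ..., bₙ are pairwise distinct, their set equals {1, 2, ..., 2n-1} ∪ {2n+1}, bᵢ > aᵢ for each i, and the set of differences {bᵢ - aᵢ : 1 ≤ i ≤ n} equals {2, 3, ..., n+1}; in other words, these pairs witness that nK₂ is (2, 1)-hooked Skolem graceful. -/
set_option maxHeartbeats 4000000 in
/-- for `r ≥ 4` and `n = 4r - 2`, the explicit piecewise-defined
pairs `(aᵢ, bᵢ)`, `1 ≤ i ≤ n`, witness that `nK₂` is `(2, 1)`-hooked Skolem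
graceful: the `2n` values are pairwise distinct, form the set
`{1, ..., 2n-1} ∪ {2n+1}`, satisfy `bᵢ > aᵢ`, and their differences form
`{2, 3, ..., n+1}`. -/
theorem stmt_13 (r n : ℕ) (hr : 4 ≤ r) (hn : n = 4 * r - 2)
    (a b : ℕ → ℕ)
    (ha1 : ∀ i, 1 ≤ i → i ≤ 2 → a i = i)
    (ha2 : ∀ i, 3 ≤ i → i ≤ 2 * r - 2 → a i = i + 1)
    (ha3 : a (2 * r - 1) = (n + 4) / 2)
    (ha4 : a (2 * r) = (3 * n + 2) / 4)
    (ha5 : ∀ i, 2 * r + 1 ≤ i → i ≤ n → a i = (n - 4) / 2 + i)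
    (hb1 : b 1 = 3)
    (hb2 : b 2 = (n + 2) / 2)
    (hb3 : ∀ i, 3 ≤ i → i ≤ r → b i = n + 2 - i)
    (hb4 : ∀ i, r + 1 ≤ i → i ≤ 2 * r - 3 → b i = n + 1 - i)
    (hb5 : b (2 * r - 2) = 3 * n / 2)
    (hb6 : b (2 * r - 1) = (3 * n - 2) / 2)
    (hb7 : b (2 * r) = (7 * n - 2) / 4)
    (hb8 : b (2 * r + 1) = 2 * n + 1)
    (hb9 : ∀ i, 2 * r + 2 ≤ i → i ≤ 3 * r → b i = (5 * n + 4) / 2 - i)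
    (hb10 : ∀ i, 3 * r + 1 ≤ i → i ≤ n → b i = (5 * n + 2) / 2 - i) :
    Set.InjOn a (Set.Icc 1 n) ∧ Set.InjOn b (Set.Icc 1 n) ∧
    Disjoint (a '' Set.Icc 1 n) (b '' Set.Icc 1 n) ∧
    a '' Set.Icc 1 n ∪ b '' Set.Icc 1 n = Set.Icc 1 (2 * n - 1) ∪ {2 * n + 1} ∧
    (∀ i ∈ Set.Icc 1 n, a i < b i) ∧
    (fun i => b i - a i) '' Set.Icc 1 n = Set.Icc 2 (n + 1) := by
  have spec : ∀ i, 1 ≤ i → i ≤ n →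
      (i = 1 ∧ a i = 1 ∧ b i = 3) ∨ (i = 2 ∧ a i = 2 ∧ b i = 2 * r) ∨
      (3 ≤ i ∧ i ≤ r ∧ a i = i + 1 ∧ b i + i = 4 * r) ∨
      (r + 1 ≤ i ∧ i ≤ 2 * r - 3 ∧ a i = i + 1 ∧ b i + i + 1 = 4 * r) ∨
      (i = 2 * r - 2 ∧ a i = 2 * r - 1 ∧ b i = 6 * r - 3) ∨
      (i = 2 * r - 1 ∧ a i = 2 * r + 1 ∧ b i = 6 * r - 4) ∨
      (i = 2 * r ∧ a i = 3 * r - 1 ∧ b i = 7 * r - 4) ∨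
      (i = 2 * r + 1 ∧ a i = 4 * r - 2 ∧ b i = 8 * r - 3) ∨
      (2 * r + 2 ≤ i ∧ i ≤ 3 * r ∧ a i + 3 = 2 * r + i ∧ b i + i + 3 = 10 * r) ∨
      (3 * r + 1 ≤ i ∧ i ≤ n ∧ a i + 3 = 2 * r + i ∧ b i + i + 4 = 10 * r) := by
    intro i h1 h2
    by_cases c : i = 1
    · subst c
      have h3 := ha1 1 (by omega) (by omega)
      refine Or.inl ?_
      omega
    by_cases c : i = 2
    · subst c
      have h3 := ha1 2 (by omega) (by omega)
      refine Or.inr (Or.inl ?_)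
      omega
    by_cases c : i = 2 * r - 2
    · subst c
      have h3 := ha2 (2 * r - 2) (by omega) (by omega)
      refine Or.inr (Or.inr (Or.inr (Or.inr (Or.inl ?_))))
      omega
    by_cases c : i = 2 * r - 1
    · subst c
      refine Or.inr (Or.inr (Or.inr (Or.inr (Or.inr (Or.inl ?_)))))
      omega
    by_cases c : i = 2 * r
    · subst c
      refine Or.inr (Or.inr (Or.inr (Or.inr (Or.inr (Or.inr (Or.inl ?_))))))
      omega
    by_cases c : i = 2 * r + 1
    · subst c
      have h3 := ha5 (2 * r + 1) (by omega) (by omega)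
      refine Or.inr (Or.inr (Or.inr (Or.inr (Or.inr (Or.inr (Or.inr (Or.inl ?_)))))))
      omega
    by_cases c : i ≤ r
    · have h3 := ha2 i (by omega) (by omega)
      have h4 := hb3 i (by omega) (by omega)
      refine Or.inr (Or.inr (Or.inl ?_))
      omega
    by_cases c : i ≤ 2 * r - 3
    · have h3 := ha2 i (by omega) (by omega)
      have h4 := hb4 i (by omega) (by omega)
      refine Or.inr (Or.inr (Or.inr (Or.inl ?_)))
      omega
    by_cases c : i ≤ 3 * r
    · have h3 := ha5 i (by omega) (by omega)
      have h4 := hb9 i (by omega) (by omega)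
      refine Or.inr (Or.inr (Or.inr (Or.inr (Or.inr (Or.inr (Or.inr (Or.inr (Or.inl ?_))))))))
      omega
    have h3 := ha5 i (by omega) (by omega)
    have h4 := hb10 i (by omega) (by omega)
    refine Or.inr (Or.inr (Or.inr (Or.inr (Or.inr (Or.inr (Or.inr (Or.inr (Or.inr ?_))))))))
    omega
  clear ha1 ha2 ha3 ha4 ha5 hb1 hb2 hb3 hb4 hb5 hb6 hb7 hb8 hb9 hb10
  refine ⟨?_, ?_, ?_, ?_, ?_, ?_⟩
  · rintro i ⟨hi, hi'⟩ j ⟨hj, hj'⟩ h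
    rcases spec i hi hi' with s | s | s | s | s | s | s | s | s | s <;>
      rcases spec j hj hj' with t | t | t | t | t | t | t | t | t | t <;> omega
  · rintro i ⟨hi, hi'⟩ j ⟨hj, hj'⟩ h
    rcases spec i hi hi' with s | s | s | s | s | s | s | s | s | s <;>
      rcases spec j hj hj' with t | t | t | t | t | t | t | t | t | t <;> omega
  · rw [Set.disjoint_left]
    rintro _ ⟨i, ⟨hi, hi'⟩, rfl⟩ ⟨j, ⟨hj, hj'⟩, h⟩
    rcases spec i hi hi' with s | s | s | s | s | s | s | s | s | s <;>
      rcases spec j hj hj' with t | t | t | t | t | t | t | t | t | t <;> omega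
  · ext x
    simp only [Set.mem_union, Set.mem_image, Set.mem_Icc, Set.mem_singleton_iff]
    constructor
    · rintro (⟨i, ⟨hi, hi'⟩, rfl⟩ | ⟨i, ⟨hi, hi'⟩, rfl⟩) <;>
        rcases spec i hi hi' with s | s | s | s | s | s | s | s | s | s <;> omega
    · intro hx
      have left : ∀ i, 1 ≤ i ∧ i ≤ n ∧ a i = x →
          (∃ i, (1 ≤ i ∧ i ≤ n) ∧ a i = x) ∨ ∃ i, (1 ≤ i ∧ i ≤ n) ∧ b i = x :=
        fun i h => Or.inl ⟨i, ⟨h.1, h.2.1⟩, h.2.2⟩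
      have right : ∀ i, 1 ≤ i ∧ i ≤ n ∧ b i = x →
          (∃ i, (1 ≤ i ∧ i ≤ n) ∧ a i = x) ∨ ∃ i, (1 ≤ i ∧ i ≤ n) ∧ b i = x :=
        fun i h => Or.inr ⟨i, ⟨h.1, h.2.1⟩, h.2.2⟩
      by_cases c1 : x ≤ 2
      · have s := spec (x) (by omega) (by omega)
        exact left (x) (by omega)
      by_cases c2 : x = 3
      · have s := spec (1) (by omega) (by omega)
        exact right (1) (by omega)
      by_cases c3 : x ≤ 2 * r - 1
      · have s := spec (x - 1) (by omega) (by omega)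
        exact left (x - 1) (by omega)
      by_cases c4 : x = 2 * r
      · have s := spec (2) (by omega) (by omega)
        exact right (2) (by omega)
      by_cases c5 : x = 2 * r + 1
      · have s := spec (2 * r - 1) (by omega) (by omega)
        exact left (2 * r - 1) (by omega)
      by_cases c6 : x ≤ 3 * r - 2
      · have s := spec (4 * r - 1 - x) (by omega) (by omega)
        exact right (4 * r - 1 - x) (by omega)
      by_cases c7 : x = 3 * r - 1
      · have s := spec (2 * r) (by omega) (by omega)
        exact left (2 * r) (by omega)
      by_cases c8 : x ≤ 4 * r - 3
      · have s := spec (4 * r - x) (by omega) (by omega)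
        exact right (4 * r - x) (by omega)
      by_cases c9 : x ≤ 6 * r - 5
      · have s := spec (x + 3 - 2 * r) (by omega) (by omega)
        exact left (x + 3 - 2 * r) (by omega)
      by_cases c10 : x = 6 * r - 4
      · have s := spec (2 * r - 1) (by omega) (by omega)
        exact right (2 * r - 1) (by omega)
      by_cases c11 : x = 6 * r - 3
      · have s := spec (2 * r - 2) (by omega) (by omega)
        exact right (2 * r - 2) (by omega)
      by_cases c12 : x ≤ 7 * r - 5
      · have s := spec (10 * r - 4 - x) (by omega) (by omega)
        exact right (10 * r - 4 - x) (by omega)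
      by_cases c13 : x = 7 * r - 4
      · have s := spec (2 * r) (by omega) (by omega)
        exact right (2 * r) (by omega)
      by_cases c14 : x = 8 * r - 3
      · have s := spec (2 * r + 1) (by omega) (by omega)
        exact right (2 * r + 1) (by omega)
      have s := spec (10 * r - 3 - x) (by omega) (by omega)
      exact right (10 * r - 3 - x) (by omega)
  · rintro i ⟨hi, hi'⟩
    rcases spec i hi hi' with s | s | s | s | s | s | s | s | s | s <;> omega
  · ext d
    simp only [Set.mem_image, Set.mem_Icc]
    constructor
    · rintro ⟨i, ⟨hi, hi'⟩, rfl⟩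
      rcases spec i hi hi' with s | s | s | s | s | s | s | s | s | s <;> omega
    · intro hd
      have wit : ∀ i, 1 ≤ i ∧ i ≤ n ∧ b i - a i = d →
          ∃ i, (1 ≤ i ∧ i ≤ n) ∧ b i - a i = d :=
        fun i h => ⟨i, ⟨h.1, h.2.1⟩, h.2.2⟩
      by_cases c1 : d = 2
      · have s := spec (1) (by omega) (by omega)
        exact wit (1) (by omega)
      by_cases c2 : d = 2 * r - 2
      · have s := spec (2) (by omega) (by omega)
        exact wit (2) (by omega)
      by_cases c3 : d = 4 * r - 2
      · have s := spec (2 * r - 2) (by omega) (by omega)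
        exact wit (2 * r - 2) (by omega)
      by_cases c4 : d = 4 * r - 5
      · have s := spec (2 * r - 1) (by omega) (by omega)
        exact wit (2 * r - 1) (by omega)
      by_cases c5 : d = 4 * r - 3
      · have s := spec (2 * r) (by omega) (by omega)
        exact wit (2 * r) (by omega)
      by_cases c6 : d = 4 * r - 1
      · have s := spec (2 * r + 1) (by omega) (by omega)
        exact wit (2 * r + 1) (by omega)
      by_cases c7 : d % 2 = 0 ∧ d ≤ 2 * r - 4
      · have s := spec (2 * r - 1 - d / 2) (by omega) (by omega)
        exact wit (2 * r - 1 - d / 2) (by omega)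
      by_cases c8 : d % 2 = 0
      · have s := spec (4 * r - d / 2) (by omega) (by omega)
        exact wit (4 * r - d / 2) (by omega)
      by_cases c9 : d ≤ 2 * r - 3
      · have s := spec (4 * r - 1 - d / 2) (by omega) (by omega)
        exact wit (4 * r - 1 - d / 2) (by omega)
      have s := spec (2 * r - 1 - d / 2) (by omega) (by omega)
      exact wit (2 * r - 1 - d / 2) (by omega)
end

section
/- Let r ≥ 3 be an integer and set n = 4r - 3. Define, for 1 ≤ i ≤ n: aᵢ = i for 1 ≤ i ≤ 2r-1; aᵢ = (n-3)/2 + i for 2r ≤ i ≤ 3r-2; aᵢ = (n-1)/2 + i for 3r-1 ≤ i ≤ n; and bᵢ = n - i for 1 ≤ i ≤ r-1; bᵢ = n - 1 + i for i = r and i = n; bᵢ = n+1-i for r+1 ≤ i ≤ 2r-2; bᵢ = (3n+1)/2 for i = 2r-1; bᵢ = 2n+1 for i = 2r; bᵢ = (5n+1)/2 - i for 2r+1 ≤ i ≤ n-1. Then the 2n numbers a₁, ..., aₙ, b₁, ..., bₙ are pairwise distinct, their set equals {1, 2, ..., 2n-1} ∪ {2n+1}, bᵢ > aᵢ for each i,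 and the set of differences {bᵢ - aᵢ : 1 ≤ i ≤ n} equals {2, 3, ..., n+1}; in other words, these pairs witness that nK₂ is (2, 1)-hooked Skolem graceful. -/
set_option maxHeartbeats 4000000 in
/-- for `r ≥ 3` and `n = 4r - 3`, the explicit piecewise-defined
pairs `(aᵢ, bᵢ)`, `1 ≤ i ≤ n`, witness that `nK₂` is `(2, 1)`-hooked Skolem
graceful: the `2n` values are pairwise distinct, form the set
`{1, ..., 2n-1} ∪ {2n+1}`, satisfy `bᵢ > aᵢ`, and their differences form
`{2, 3, ..., n+1}`. -/
theorem stmt_14 (r n : ℕ) (hr : 3 ≤ r) (hn : n = 4 * r - 3)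
    (a b : ℕ → ℕ)
    (ha1 : ∀ i, 1 ≤ i → i ≤ 2 * r - 1 → a i = i)
    (ha2 : ∀ i, 2 * r ≤ i → i ≤ 3 * r - 2 → a i = (n - 3) / 2 + i)
    (ha3 : ∀ i, 3 * r - 1 ≤ i → i ≤ n → a i = (n - 1) / 2 + i)
    (hb1 : ∀ i, 1 ≤ i → i ≤ r - 1 → b i = n - i)
    (hb2 : b r = n - 1 + r)
    (hb3 : b n = n - 1 + n)
    (hb4 : ∀ i, r + 1 ≤ i → i ≤ 2 * r - 2 → b i = n + 1 - i)
    (hb5 : b (2 * r - 1) = (3 * n + 1) / 2)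
    (hb6 : b (2 * r) = 2 * n + 1)
    (hb7 : ∀ i, 2 * r + 1 ≤ i → i ≤ n - 1 → b i = (5 * n + 1) / 2 - i) :
    Set.InjOn a (Set.Icc 1 n) ∧ Set.InjOn b (Set.Icc 1 n) ∧
    Disjoint (a '' Set.Icc 1 n) (b '' Set.Icc 1 n) ∧
    a '' Set.Icc 1 n ∪ b '' Set.Icc 1 n = Set.Icc 1 (2 * n - 1) ∪ {2 * n + 1} ∧
    (∀ i ∈ Set.Icc 1 n, a i < b i) ∧
    (fun i => b i - a i) '' Set.Icc 1 n = Set.Icc 2 (n + 1) := by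
  have ha : ∀ i, 1 ≤ i → i ≤ n → (i ≤ 2 * r - 1 ∧ a i = i) ∨
      (2 * r ≤ i ∧ i ≤ 3 * r - 2 ∧ a i = 2 * r - 3 + i) ∨
      (3 * r - 1 ≤ i ∧ a i = 2 * r - 2 + i) := by
    intro i h1 h2
    rcases (by omega : i ≤ 2 * r - 1 ∨ (2 * r ≤ i ∧ i ≤ 3 * r - 2) ∨ 3 * r - 1 ≤ i)
      with h | h | h
    · exact .inl ⟨h, ha1 i h1 h⟩
    · exact .inr (.inl ⟨h.1, h.2, by rw [ha2 i h.1 h.2]; omega⟩)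
    · exact .inr (.inr ⟨h, by rw [ha3 i h h2]; omega⟩)
  have hb : ∀ i, 1 ≤ i → i ≤ n → (i ≤ r - 1 ∧ b i = 4 * r - 3 - i) ∨
      (i = r ∧ b i = 5 * r - 4) ∨
      (r + 1 ≤ i ∧ i ≤ 2 * r - 2 ∧ b i = 4 * r - 2 - i) ∨
      (i = 2 * r - 1 ∧ b i = 6 * r - 4) ∨
      (i = 2 * r ∧ b i = 8 * r - 5) ∨
      (2 * r + 1 ≤ i ∧ i ≤ n - 1 ∧ b i = 10 * r - 7 - i) ∨
      (i = n ∧ b i = 8 * r - 7) := by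
    intro i h1 h2
    rcases (by omega : i ≤ r - 1 ∨ i = r ∨ (r + 1 ≤ i ∧ i ≤ 2 * r - 2) ∨ i = 2 * r - 1 ∨
        i = 2 * r ∨ (2 * r + 1 ≤ i ∧ i ≤ n - 1) ∨ i = n) with h | h | h | h | h | h | h
    · exact .inl ⟨h, by rw [hb1 i h1 h]; omega⟩
    · exact .inr (.inl ⟨h, by rw [h, hb2]; omega⟩)
    · exact .inr (.inr (.inl ⟨h.1, h.2, by rw [hb4 i h.1 h.2]; omega⟩))
    · exact .inr (.inr (.inr (.inl ⟨h, by rw [h, hb5]; omega⟩)))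
    · exact .inr (.inr (.inr (.inr (.inl ⟨h, by rw [h, hb6]; omega⟩))))
    · exact .inr (.inr (.inr (.inr (.inr (.inl ⟨h.1, h.2, by rw [hb7 i h.1 h.2]; omega⟩)))))
    · exact .inr (.inr (.inr (.inr (.inr (.inr ⟨h, by rw [h, hb3]; omega⟩)))))
  clear ha1 ha2 ha3 hb1 hb4 hb7
  refine ⟨?_, ?_, ?_, ?_, ?_, ?_⟩
  · rintro i ⟨hi1, hi2⟩ j ⟨hj1, hj2⟩ hij
    have := ha i hi1 hi2
    have := ha j hj1 hj2
    omega
  · rintro i ⟨hi1, hi2⟩ j ⟨hj1, hj2⟩ hij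
    have := hb j hj1 hj2
    rcases hb i hi1 hi2 with h | h | h | h | h | h | h <;> omega
  · rw [Set.disjoint_left]
    rintro _ ⟨i, ⟨hi1, hi2⟩, rfl⟩ ⟨j, ⟨hj1, hj2⟩, hij⟩
    have := hb j hj1 hj2
    rcases ha i hi1 hi2 with h | h | h <;> omega
  · ext x
    simp only [Set.mem_union, Set.mem_image, Set.mem_Icc, Set.mem_singleton_iff]
    constructor
    · rintro (⟨i, ⟨hi1, hi2⟩, rfl⟩ | ⟨i, ⟨hi1, hi2⟩, rfl⟩)
      · have := ha i hi1 hi2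
        omega
      · have := hb i hi1 hi2
        omega
    · intro hx
      have ofA : ∀ i, 1 ≤ i ∧ i ≤ n → a i = x →
          (∃ i, (1 ≤ i ∧ i ≤ n) ∧ a i = x) ∨ ∃ i, (1 ≤ i ∧ i ≤ n) ∧ b i = x :=
        fun i hi h => .inl ⟨i, hi, h⟩
      have ofB : ∀ i, 1 ≤ i ∧ i ≤ n → b i = x →
          (∃ i, (1 ≤ i ∧ i ≤ n) ∧ a i = x) ∨ ∃ i, (1 ≤ i ∧ i ≤ n) ∧ b i = x :=
        fun i hi h => .inr ⟨i, hi, h⟩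
      rcases (by omega : (1 ≤ x ∧ x ≤ 2 * r - 1) ∨ (2 * r ≤ x ∧ x ≤ 3 * r - 3) ∨
          (3 * r - 2 ≤ x ∧ x ≤ 4 * r - 4) ∨ (4 * r - 3 ≤ x ∧ x ≤ 5 * r - 5) ∨ x = 5 * r - 4 ∨
          (5 * r - 3 ≤ x ∧ x ≤ 6 * r - 5) ∨ x = 6 * r - 4 ∨ (6 * r - 3 ≤ x ∧ x ≤ 8 * r - 8) ∨
          x = 8 * r - 7 ∨ x = 8 * r - 5) with h | h | h | h | h | h | h | h | h | h
      · exact ofA x (by omega) (by have := ha x; omega)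
      · exact ofB (4 * r - 2 - x) (by omega) (by have := hb (4 * r - 2 - x); omega)
      · exact ofB (4 * r - 3 - x) (by omega) (by have := hb (4 * r - 3 - x); omega)
      · exact ofA (x - (2 * r - 3)) (by omega) (by have := ha (x - (2 * r - 3)); omega)
      · exact ofB r (by omega) (by omega)
      · exact ofA (x - (2 * r - 2)) (by omega) (by have := ha (x - (2 * r - 2)); omega)
      · exact ofB (2 * r - 1) (by omega) (by omega)
      · exact ofB (10 * r - 7 - x) (by omega) (by have := hb (10 * r - 7 - x); omega)
      · exact ofB n (by omega) (by omega)
      · exact ofB (2 * r) (by omega) (by omega)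
  · rintro i ⟨hi1, hi2⟩
    have := hb i hi1 hi2
    rcases ha i hi1 hi2 with h | h | h <;> omega
  · ext x
    simp only [Set.mem_image, Set.mem_Icc]
    constructor
    · rintro ⟨i, ⟨hi1, hi2⟩, rfl⟩
      have := hb i hi1 hi2
      rcases ha i hi1 hi2 with h | h | h <;> omega
    · intro hx
      have of_index : ∀ i, 1 ≤ i ∧ i ≤ n → b i - a i = x →
          ∃ i, (1 ≤ i ∧ i ≤ n) ∧ b i - a i = x := fun i hi h => ⟨i, hi, h⟩
      rcases Nat.even_or_odd' x with ⟨k, hk | hk⟩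
      · rcases (by omega : k ≤ r - 2 ∨ k = r - 1 ∨ (r ≤ k ∧ k ≤ 2 * r - 3) ∨
            k = 2 * r - 2 ∨ k = 2 * r - 1) with h | h | h | h | h
        · have hi : 1 ≤ 2 * r - 1 - k ∧ 2 * r - 1 - k ≤ n := by omega
          have := ha _ hi.1 hi.2
          have := hb _ hi.1 hi.2
          exact of_index _ hi (by omega)
        · have hi : 1 ≤ n ∧ n ≤ n := by omega
          have := ha _ hi.1 hi.2
          exact of_index _ hi (by omega)
        · have hi : 1 ≤ 4 * r - 2 - k ∧ 4 * r - 2 - k ≤ n := by omega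
          have := ha _ hi.1 hi.2
          have := hb _ hi.1 hi.2
          exact of_index _ hi (by omega)
        · have hi : 1 ≤ r ∧ r ≤ n := by omega
          have := ha _ hi.1 hi.2
          exact of_index _ hi (by omega)
        · have hi : 1 ≤ 2 * r ∧ 2 * r ≤ n := by omega
          have := ha _ hi.1 hi.2
          exact of_index _ hi (by omega)
      · rcases (by omega : k ≤ r - 2 ∨ (r - 1 ≤ k ∧ k ≤ 2 * r - 3) ∨ k = 2 * r - 2)
          with h | h | h
        · have hi : 1 ≤ 4 * r - 3 - k ∧ 4 * r - 3 - k ≤ n := by omega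
          have := ha _ hi.1 hi.2
          have := hb _ hi.1 hi.2
          exact of_index _ hi (by omega)
        · have hi : 1 ≤ 2 * r - 2 - k ∧ 2 * r - 2 - k ≤ n := by omega
          have := ha _ hi.1 hi.2
          have := hb _ hi.1 hi.2
          exact of_index _ hi (by omega)
        · have hi : 1 ≤ 2 * r - 1 ∧ 2 * r - 1 ≤ n := by omega
          have := ha _ hi.1 hi.2
          exact of_index _ hi (by omega)
end
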